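/- Fix 0 < ε₁ < ε₂ < ε₃. There exists a constant C > 0, independent of the solution and of S, T, such that every classical solution of system (S) satisfies, for every 0 ≤ S ≤ T: ∫_S^T ∫_{1−ε₁}^{1} (u_t(t,x)² + a(x)u_x(t,x)²) dx dt + ∫_S^T η₂(t)² dt ≤ C ∫_S^T ∫_{1−ε₂}^{1} (u(t,x) − u_*)² dx dt + C E(S). -/

import Mathlib

open Set MeasureTheory

/-- A classical solution of system (S): a wave equation with localized in-domain damping and
Wentzell (dynamic) boundary conditions. -/
structure ClassicalSolutionS (a q : ℝ → ℝ) (α₁ α₂ β₁ γ₁ μ₁ : ℝ) where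
  u : ℝ → ℝ → ℝ
  ut : ℝ → ℝ → ℝ
  ux : ℝ → ℝ → ℝ
  utt : ℝ → ℝ → ℝ
  dAux : ℝ → ℝ → ℝ
  η₁ : ℝ → ℝ
  η₂ : ℝ → ℝ
  ζ₁ : ℝ → ℝ
  hu_t : ∀ t ∈ Ici (0:ℝ), ∀ x ∈ Icc (0:ℝ) 1, HasDerivAt (fun s => u s x) (ut t x) t
  hu_x : ∀ t ∈ Ici (0:ℝ), ∀ x ∈ Icc (0:ℝ) 1, HasDerivAt (fun y => u t y) (ux t x) x
  hut_C1 : ContDiffOn ℝ 1 (fun p : ℝ × ℝ => ut p.1 p.2) (Ici (0:ℝ) ×ˢ Icc (0:ℝ) 1)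
  hux_C1 : ContDiffOn ℝ 1 (fun p : ℝ × ℝ => ux p.1 p.2) (Ici (0:ℝ) ×ˢ Icc (0:ℝ) 1)
  hu_tt : ∀ t ∈ Ici (0:ℝ), ∀ x ∈ Icc (0:ℝ) 1, HasDerivAt (fun s => ut s x) (utt t x) t
  haux_lip : ∀ t ∈ Ici (0:ℝ),
      ∃ K : NNReal, LipschitzOnWith K (fun x => a x * ux t x) (Icc (0:ℝ) 1)
  haux : ∀ t ∈ Ici (0:ℝ), ∀ᵐ x ∂(volume.restrict (Ioo (0:ℝ) 1)),
      HasDerivAt (fun y => a y * ux t y) (dAux t x) x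
  hPDE : ∀ t ∈ Ici (0:ℝ), ∀ᵐ x ∂(volume.restrict (Ioo (0:ℝ) 1)),
      utt t x - dAux t x = - q x * ut t x
  hbc1 : ∀ t ∈ Ici (0:ℝ), ut t 1 = η₁ t
  hbc0 : ∀ t ∈ Ici (0:ℝ), ut t 0 = ζ₁ t
  hη₁C1 : ContDiffOn ℝ 1 η₁ (Ici (0:ℝ))
  hη₂C1 : ContDiffOn ℝ 1 η₂ (Ici (0:ℝ))
  hζ₁C1 : ContDiffOn ℝ 1 ζ₁ (Ici (0:ℝ))
  hode1 : ∀ t ∈ Ici (0:ℝ), HasDerivAt η₁ (-α₁ * η₁ t - α₂ * η₂ t - β₁ * ux t 1) t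
  hode2 : ∀ t ∈ Ici (0:ℝ), HasDerivAt η₂ (η₁ t) t
  hode3 : ∀ t ∈ Ici (0:ℝ), HasDerivAt ζ₁ (-γ₁ * ζ₁ t + μ₁ * ux t 0) t

/-- The energy of a classical solution of system (S). -/
noncomputable def energyS {a q : ℝ → ℝ} {α₁ α₂ β₁ γ₁ μ₁ : ℝ}
    (sol : ClassicalSolutionS a q α₁ α₂ β₁ γ₁ μ₁) (t : ℝ) : ℝ :=
  (1/2) * (∫ x in (0:ℝ)..1, (sol.ut t x ^ 2 + a x * sol.ux t x ^ 2))
    + (a 1 / (2 * β₁)) * sol.η₁ t ^ 2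
    + (a 1 * α₂ / (2 * β₁)) * sol.η₂ t ^ 2
    + (a 0 / (2 * μ₁)) * sol.ζ₁ t ^ 2

/-- Assumption (A1): `a` is Lipschitz on `[0,1]` and bounded below and above by positive
constants `a_min ≤ a_max`. -/
def AssumptionA1 (a : ℝ → ℝ) (a_min a_max : ℝ) : Prop :=
  (∃ K : NNReal, LipschitzOnWith K a (Icc (0:ℝ) 1)) ∧ 0 < a_min ∧ a_min ≤ a_max ∧
    ∀ x ∈ Icc (0:ℝ) 1, a_min ≤ a x ∧ a x ≤ a_max

/-- Assumption (A2'): `q` is bounded measurable, nonnegative a.e., and bounded below by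
`q_min > 0` a.e. on the interval `(1-ε₃, 1)`. -/
def AssumptionA2' (q : ℝ → ℝ) (ε₃ q_min : ℝ) : Prop :=
  Measurable q ∧ (∃ Q : ℝ, ∀ x ∈ Icc (0:ℝ) 1, |q x| ≤ Q) ∧
    (∀ᵐ x ∂(volume.restrict (Ioo (0:ℝ) 1)), 0 ≤ q x) ∧
    0 < ε₃ ∧ ε₃ < 1 ∧ 0 < q_min ∧
    ∀ᵐ x ∂(volume.restrict (Ioo (1 - ε₃) 1)), q_min ≤ q x

/-- Continuous dependence on the parameter, and on the upper endpoint, of the integral over a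
subinterval of `[0,1]` of a function that is continuous on the closed half-strip. -/
theorem continuousOn_halfStrip_primitive {F : ℝ → ℝ → ℝ}
    (hF : ContinuousOn (fun p : ℝ × ℝ => F p.1 p.2) (Ici (0:ℝ) ×ˢ Icc (0:ℝ) 1))
    {c : ℝ} (hc : c ∈ Icc (0:ℝ) 1) :
    ContinuousOn (fun p : ℝ × ℝ => ∫ x in c..p.2, F p.1 x) (Ici (0:ℝ) ×ˢ Icc (0:ℝ) 1) := by
  have hG : Continuous (fun p : ℝ × ℝ => F (max p.1 0) (max 0 (min p.2 1))) := by
    refine hF.comp_continuous (f := fun p : ℝ × ℝ => (max p.1 0, max 0 (min p.2 1)))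
      (by fun_prop) fun p => ⟨?_, ?_, ?_⟩ <;> simp
  have hG' : Continuous (Function.uncurry fun (p : ℝ × ℝ) (x : ℝ) =>
      F (max p.1 0) (max 0 (min x 1))) :=
    hG.comp (f := fun r : (ℝ × ℝ) × ℝ => (r.1.1, r.2)) (by fun_prop)
  have := intervalIntegral.continuous_parametric_intervalIntegral_of_continuous
    (μ := volume) (a₀ := c) hG' (s := fun p : ℝ × ℝ => p.2) continuous_snd
  refine this.continuousOn.congr fun p hp => ?_
  refine intervalIntegral.integral_congr fun x hx => ?_
  have hx' : x ∈ Icc (0:ℝ) 1 := uIcc_subset_Icc hc hp.2 hx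
  have h0 : (0:ℝ) ≤ p.1 := hp.1
  simp [max_eq_left h0, min_eq_left hx'.2, max_eq_right hx'.1]

theorem continuousOn_integral_of_continuousOn_halfStrip {F : ℝ → ℝ → ℝ}
    (hF : ContinuousOn (fun p : ℝ × ℝ => F p.1 p.2) (Ici (0:ℝ) ×ˢ Icc (0:ℝ) 1))
    {c : ℝ} (hc : c ∈ Icc (0:ℝ) 1) :
    ContinuousOn (fun t => ∫ x in c..1, F t x) (Ici (0:ℝ)) :=
  (continuousOn_halfStrip_primitive hF hc).comp (f := fun t : ℝ => (t, (1:ℝ)))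
    (by fun_prop) fun t ht => ⟨ht, by simp⟩

theorem continuousOn_slice {F : ℝ → ℝ → ℝ}
    (hF : ContinuousOn (fun p : ℝ × ℝ => F p.1 p.2) (Ici (0:ℝ) ×ˢ Icc (0:ℝ) 1))
    {t : ℝ} (ht : 0 ≤ t) : ContinuousOn (F t) (Icc (0:ℝ) 1) :=
  hF.comp (f := fun x : ℝ => (t, x)) (by fun_prop) fun _ hx => ⟨ht, hx⟩

theorem intervalIntegrable_of_continuousOn_unit {f : ℝ → ℝ} (hf : ContinuousOn f (Icc (0:ℝ) 1))
    {c d : ℝ} (hc : c ∈ Icc (0:ℝ) 1) (hd : d ∈ Icc (0:ℝ) 1) :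
    IntervalIntegrable f volume c d :=
  (hf.mono (uIcc_subset_Icc hc hd)).intervalIntegrable

/-- Differentiation under the integral sign on the half-strip. -/
theorem hasDerivAt_integral_of_continuousOn_halfStrip {F G : ℝ → ℝ → ℝ}
    (hF : ContinuousOn (fun p : ℝ × ℝ => F p.1 p.2) (Ici (0:ℝ) ×ˢ Icc (0:ℝ) 1))
    (hG : ContinuousOn (fun p : ℝ × ℝ => G p.1 p.2) (Ici (0:ℝ) ×ˢ Icc (0:ℝ) 1))
    (hFG : ∀ t > (0:ℝ), ∀ x ∈ Icc (0:ℝ) 1, HasDerivAt (fun s => F s x) (G t x) t)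
    {c : ℝ} (hc : c ∈ Icc (0:ℝ) 1) {t : ℝ} (ht : 0 < t) :
    HasDerivAt (fun s => ∫ x in c..1, F s x) (∫ x in c..1, G t x) t := by
  have h1 : (1:ℝ) ∈ Icc (0:ℝ) 1 := by simp
  have hK : IsCompact (Icc (t/2) (2*t) ×ˢ Icc (0:ℝ) 1) := isCompact_Icc.prod isCompact_Icc
  obtain ⟨M, hM⟩ := hK.exists_bound_of_continuousOn
    (hG.mono (prod_mono (fun s hs => le_trans (by positivity) hs.1) subset_rfl))
  have hsub : uIoc c 1 ⊆ Icc (0:ℝ) 1 := uIoc_subset_uIcc.trans (uIcc_subset_Icc hc h1)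
  refine (intervalIntegral.hasDerivAt_integral_of_dominated_loc_of_deriv_le
    (s := Icc (t/2) (2*t)) (bound := fun _ => M)
    (Icc_mem_nhds (by linarith) (by linarith)) ?_ ?_ ?_ ?_ (by simp) ?_).2
  · filter_upwards [lt_mem_nhds ht] with s hs
    exact (intervalIntegrable_of_continuousOn_unit
      (continuousOn_slice hF hs.le) hc h1).def'.aestronglyMeasurable
  · exact intervalIntegrable_of_continuousOn_unit (continuousOn_slice hF ht.le) hc h1
  · exact (intervalIntegrable_of_continuousOn_unit
      (continuousOn_slice hG ht.le) hc h1).def'.aestronglyMeasurable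
  · exact Filter.Eventually.of_forall fun x hx s hs => hM (s, x) ⟨hs, hsub hx⟩
  · exact Filter.Eventually.of_forall fun x hx s hs =>
      hFG s (lt_of_lt_of_le (by positivity) hs.1) x (hsub hx)

theorem absolutelyContinuousOnInterval_of_hasDerivWithinAt {f f' : ℝ → ℝ} {a b : ℝ}
    (hf : ∀ x ∈ uIcc a b, HasDerivWithinAt f (f' x) (uIcc a b) x)
    (hf' : ContinuousOn f' (uIcc a b)) : AbsolutelyContinuousOnInterval f a b := by
  obtain ⟨M, hM⟩ := isCompact_uIcc.exists_bound_of_continuousOn hf'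
  refine (Convex.lipschitzOnWith_of_nnnorm_hasDerivWithin_le (C := M.toNNReal)
    (convex_uIcc a b) hf fun x hx => ?_).absolutelyContinuousOnInterval
  rw [← NNReal.coe_le_coe, coe_nnnorm]
  exact (hM x hx).trans (Real.le_coe_toNNReal M)

/-- Integration by parts against a Lipschitz function with a prescribed almost everywhere
derivative. -/
theorem integral_by_parts_of_lipschitz {f f' W W' : ℝ → ℝ} {a b : ℝ} {K : NNReal} (hab : a ≤ b)
    (hf : ∀ x ∈ Icc a b, HasDerivWithinAt f (f' x) (Icc a b) x)
    (hf' : ContinuousOn f' (Icc a b)) (hW : LipschitzOnWith K W (Icc a b))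
    (hW' : ∀ᵐ x ∂(volume.restrict (Ioo a b)), HasDerivAt W (W' x) x) :
    ∫ x in a..b, (f' x * W x + f x * W' x) = f b * W b - f a * W a := by
  rw [← uIcc_of_le hab] at hf hf' hW
  rw [← (absolutelyContinuousOnInterval_of_hasDerivWithinAt hf hf').integral_deriv_mul_eq_sub
    hW.absolutelyContinuousOnInterval]
  rw [intervalIntegral.integral_of_le hab, intervalIntegral.integral_of_le hab,
    integral_Ioc_eq_integral_Ioo, integral_Ioc_eq_integral_Ioo]
  refine integral_congr_ae ?_
  filter_upwards [hW', ae_restrict_mem measurableSet_Ioo] with x hx hx'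
  rw [uIcc_of_le hab] at hf
  rw [hx.deriv, ((hf x (Ioo_subset_Icc_self hx')).hasDerivAt
    (Icc_mem_nhds hx'.1 hx'.2)).deriv]

theorem sq_integral_le_integral_sq {f : ℝ → ℝ} {c d : ℝ} (hcd : c ≤ d) (hlen : d - c ≤ 1)
    (hf : ContinuousOn f (Icc c d)) :
    (∫ x in c..d, f x) ^ 2 ≤ ∫ x in c..d, f x ^ 2 := by
  rw [← uIcc_of_le hcd] at hf
  set m := ∫ x in c..d, f x with hm
  have h0 : 0 ≤ ∫ x in c..d, (f x ^ 2 + ((-2 * m) * f x + m ^ 2)) :=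
    intervalIntegral.integral_nonneg hcd fun x _ => by nlinarith [sq_nonneg (f x - m)]
  have h1 : IntervalIntegrable (fun x => f x ^ 2) volume c d := (hf.pow 2).intervalIntegrable
  have h2 : IntervalIntegrable (fun x => -2 * m * f x) volume c d :=
    (hf.intervalIntegrable).const_mul _
  rw [intervalIntegral.integral_add h1 (h2.add (by simp)),
    intervalIntegral.integral_add h2 (by simp),
    intervalIntegral.integral_const_mul, ← hm, intervalIntegral.integral_const,
    smul_eq_mul] at h0
  nlinarith [sq_nonneg m]

/-- The time derivative of a function on the closed half-strip, one-sided at the boundary. -/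
noncomputable def stripTimeDeriv (f : ℝ → ℝ → ℝ) (t x : ℝ) : ℝ :=
  fderivWithin ℝ (fun p : ℝ × ℝ => f p.1 p.2) (Ici (0:ℝ) ×ˢ Icc (0:ℝ) 1) (t, x) (1, 0)

/-- The space derivative of a function on the closed half-strip, one-sided at the boundary. -/
noncomputable def stripSpaceDeriv (f : ℝ → ℝ → ℝ) (t x : ℝ) : ℝ :=
  fderivWithin ℝ (fun p : ℝ × ℝ => f p.1 p.2) (Ici (0:ℝ) ×ˢ Icc (0:ℝ) 1) (t, x) (0, 1)

section HalfStrip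

variable {f : ℝ → ℝ → ℝ}

theorem continuousOn_fderivWithin_halfStrip
    (hf : ContDiffOn ℝ 1 (fun p : ℝ × ℝ => f p.1 p.2) (Ici (0:ℝ) ×ˢ Icc (0:ℝ) 1)) :
    ContinuousOn (fderivWithin ℝ (fun p : ℝ × ℝ => f p.1 p.2) (Ici (0:ℝ) ×ˢ Icc (0:ℝ) 1))
      (Ici (0:ℝ) ×ˢ Icc (0:ℝ) 1) :=
  hf.continuousOn_fderivWithin ((uniqueDiffOn_Ici 0).prod (uniqueDiffOn_Icc one_pos)) le_rfl

theorem continuousOn_stripTimeDeriv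
    (hf : ContDiffOn ℝ 1 (fun p : ℝ × ℝ => f p.1 p.2) (Ici (0:ℝ) ×ˢ Icc (0:ℝ) 1)) :
    ContinuousOn (fun p : ℝ × ℝ => stripTimeDeriv f p.1 p.2) (Ici (0:ℝ) ×ˢ Icc (0:ℝ) 1) :=
  (continuousOn_fderivWithin_halfStrip hf).clm_apply continuousOn_const

theorem continuousOn_stripSpaceDeriv
    (hf : ContDiffOn ℝ 1 (fun p : ℝ × ℝ => f p.1 p.2) (Ici (0:ℝ) ×ˢ Icc (0:ℝ) 1)) :
    ContinuousOn (fun p : ℝ × ℝ => stripSpaceDeriv f p.1 p.2) (Ici (0:ℝ) ×ˢ Icc (0:ℝ) 1) :=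
  (continuousOn_fderivWithin_halfStrip hf).clm_apply continuousOn_const

theorem hasFDerivWithinAt_halfStrip
    (hf : ContDiffOn ℝ 1 (fun p : ℝ × ℝ => f p.1 p.2) (Ici (0:ℝ) ×ˢ Icc (0:ℝ) 1))
    {t x : ℝ} (ht : 0 ≤ t) (hx : x ∈ Icc (0:ℝ) 1) :
    HasFDerivWithinAt (fun p : ℝ × ℝ => f p.1 p.2)
      (fderivWithin ℝ (fun p : ℝ × ℝ => f p.1 p.2) (Ici (0:ℝ) ×ˢ Icc (0:ℝ) 1) (t, x))
      (Ici (0:ℝ) ×ˢ Icc (0:ℝ) 1) (t, x) :=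
  ((hf.differentiableOn one_ne_zero) (t, x) ⟨ht, hx⟩).hasFDerivWithinAt

theorem hasFDerivAt_halfStrip
    (hf : ContDiffOn ℝ 1 (fun p : ℝ × ℝ => f p.1 p.2) (Ici (0:ℝ) ×ˢ Icc (0:ℝ) 1))
    {t x : ℝ} (ht : 0 < t) (hx : x ∈ Ioo (0:ℝ) 1) :
    HasFDerivAt (fun p : ℝ × ℝ => f p.1 p.2)
      (fderivWithin ℝ (fun p : ℝ × ℝ => f p.1 p.2) (Ici (0:ℝ) ×ˢ Icc (0:ℝ) 1) (t, x)) (t, x) :=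
  (hasFDerivWithinAt_halfStrip hf ht.le (Ioo_subset_Icc_self hx)).hasFDerivAt
    (prod_mem_nhds (Ici_mem_nhds ht) (Icc_mem_nhds hx.1 hx.2))

theorem hasDerivAt_stripTimeDeriv
    (hf : ContDiffOn ℝ 1 (fun p : ℝ × ℝ => f p.1 p.2) (Ici (0:ℝ) ×ˢ Icc (0:ℝ) 1))
    {t x : ℝ} (ht : 0 < t) (hx : x ∈ Icc (0:ℝ) 1) :
    HasDerivAt (fun s => f s x) (stripTimeDeriv f t x) t :=
  ((hasFDerivWithinAt_halfStrip hf ht.le hx).comp_hasDerivWithinAt (f := fun s : ℝ => (s, x))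
    (s := Ici 0) t ((hasDerivAt_id t).prodMk (hasDerivAt_const t x)).hasDerivWithinAt
    fun _ hs => ⟨hs, hx⟩).hasDerivAt (Ici_mem_nhds ht)

theorem hasDerivWithinAt_stripSpaceDeriv
    (hf : ContDiffOn ℝ 1 (fun p : ℝ × ℝ => f p.1 p.2) (Ici (0:ℝ) ×ˢ Icc (0:ℝ) 1))
    {t x : ℝ} (ht : 0 ≤ t) (hx : x ∈ Icc (0:ℝ) 1) :
    HasDerivWithinAt (f t) (stripSpaceDeriv f t x) (Icc (0:ℝ) 1) x :=
  (hasFDerivWithinAt_halfStrip hf ht hx).comp_hasDerivWithinAt (f := fun y : ℝ => (t, y))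
    x ((hasDerivAt_const x t).prodMk (hasDerivAt_id x)).hasDerivWithinAt
    fun _ hs => ⟨ht, hs⟩

end HalfStrip

/-- Equality of mixed partial derivatives. -/
theorem stripSpaceDeriv_eq_stripTimeDeriv {u ut ux : ℝ → ℝ → ℝ}
    (hu_t : ∀ t ∈ Ici (0:ℝ), ∀ x ∈ Icc (0:ℝ) 1, HasDerivAt (fun s => u s x) (ut t x) t)
    (hu_x : ∀ t ∈ Ici (0:ℝ), ∀ x ∈ Icc (0:ℝ) 1, HasDerivAt (fun y => u t y) (ux t x) x)
    (hut : ContDiffOn ℝ 1 (fun p : ℝ × ℝ => ut p.1 p.2) (Ici (0:ℝ) ×ˢ Icc (0:ℝ) 1))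
    (hux : ContDiffOn ℝ 1 (fun p : ℝ × ℝ => ux p.1 p.2) (Ici (0:ℝ) ×ˢ Icc (0:ℝ) 1))
    {t x : ℝ} (ht : 0 < t) (hx : x ∈ Ioo (0:ℝ) 1) :
    stripSpaceDeriv ut t x = stripTimeDeriv ux t x := by
  have hnhds : ∀ s > (0:ℝ), ∀ y ∈ Ioo (0:ℝ) 1,
      Ioi (0:ℝ) ×ˢ Ioo (0:ℝ) 1 ∈ nhds ((s, y) : ℝ × ℝ) := fun s hs y hy =>
    prod_mem_nhds (Ioi_mem_nhds hs) (Ioo_mem_nhds hy.1 hy.2)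
  have hu : ∀ s > (0:ℝ), ∀ y ∈ Ioo (0:ℝ) 1,
      HasFDerivAt (fun p : ℝ × ℝ => u p.1 p.2)
        (ut s y • ContinuousLinearMap.fst ℝ ℝ ℝ + ux s y • ContinuousLinearMap.snd ℝ ℝ ℝ)
        (s, y) := by
    intro s hs y hy
    have := (hasStrictFDerivAt_uncurry_coprod (𝕜 := ℝ) (u := (s, y)) (f := u)
      (f₁ := fun t x => ut t x • (1 : ℝ →L[ℝ] ℝ)) (f₂ := fun t x => ux t x • (1 : ℝ →L[ℝ] ℝ))
      ?_ ?_ ?_ ?_).hasFDerivAt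
    · have e : ut s y • ContinuousLinearMap.fst ℝ ℝ ℝ + ux s y • ContinuousLinearMap.snd ℝ ℝ ℝ =
          (ut s y • (1 : ℝ →L[ℝ] ℝ)).coprod (ux s y • (1 : ℝ →L[ℝ] ℝ)) := by
        ext <;> simp
      rw [e]
      exact this
    · filter_upwards [hnhds s hs y hy] with p hp
      rw [hasFDerivAt_iff_hasDerivAt]
      simpa [Function.HasUncurry.uncurry] using
        hu_t p.1 (Ioi_subset_Ici_self hp.1) p.2 (Ioo_subset_Icc_self hp.2)
    · filter_upwards [hnhds s hs y hy] with p hp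
      rw [hasFDerivAt_iff_hasDerivAt]
      simpa [Function.HasUncurry.uncurry] using
        hu_x p.1 (Ioi_subset_Ici_self hp.1) p.2 (Ioo_subset_Icc_self hp.2)
    · exact (hasFDerivAt_halfStrip hut hs hy).continuousAt.smul continuousAt_const
    · exact (hasFDerivAt_halfStrip hux hs hy).continuousAt.smul continuousAt_const
  have h2 := ((hasFDerivAt_halfStrip hut ht hx).smul_const (ContinuousLinearMap.fst ℝ ℝ ℝ)).add
    ((hasFDerivAt_halfStrip hux ht hx).smul_const (ContinuousLinearMap.snd ℝ ℝ ℝ))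
  have h1 : ∀ᶠ p in nhds ((t, x) : ℝ × ℝ), HasFDerivAt (fun p : ℝ × ℝ => u p.1 p.2)
      (ut p.1 p.2 • ContinuousLinearMap.fst ℝ ℝ ℝ + ux p.1 p.2 • ContinuousLinearMap.snd ℝ ℝ ℝ)
      p := by
    filter_upwards [hnhds t ht x hx] with p hp using hu p.1 hp.1 p.2 hp.2
  have := second_derivative_symmetric_of_eventually h1 h2 (0, 1) (1, 0)
  simpa [stripSpaceDeriv, stripTimeDeriv] using this

/-- A function with continuous partial derivatives on the closed half-strip is continuous. -/
theorem continuousOn_halfStrip_of_hasDerivAt {u ux : ℝ → ℝ → ℝ}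
    (hu_t : ContinuousOn (fun t => u t 0) (Ici (0:ℝ)))
    (hu_x : ∀ t ∈ Ici (0:ℝ), ∀ x ∈ Icc (0:ℝ) 1, HasDerivAt (fun y => u t y) (ux t x) x)
    (hux : ContinuousOn (fun p : ℝ × ℝ => ux p.1 p.2) (Ici (0:ℝ) ×ˢ Icc (0:ℝ) 1)) :
    ContinuousOn (fun p : ℝ × ℝ => u p.1 p.2) (Ici (0:ℝ) ×ˢ Icc (0:ℝ) 1) := by
  have h0 : (0:ℝ) ∈ Icc (0:ℝ) 1 := by simp
  have h := (hu_t.comp (f := fun p : ℝ × ℝ => p.1) continuousOn_fst fun p hp => hp.1).add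
    (continuousOn_halfStrip_primitive hux h0)
  refine h.congr fun p hp => ?_
  have := intervalIntegral.integral_eq_sub_of_hasDerivAt (a := 0) (b := p.2)
    (f := fun y => u p.1 y) (f' := ux p.1)
    (fun x hx => hu_x p.1 hp.1 x (uIcc_subset_Icc h0 hp.2 hx))
    (intervalIntegrable_of_continuousOn_unit (continuousOn_slice hux hp.1) h0 hp.2)
  simp [this]

theorem AssumptionA1.continuousOn {a : ℝ → ℝ} {a_min a_max : ℝ} (h : AssumptionA1 a a_min a_max) :
    ContinuousOn a (Icc (0:ℝ) 1) :=
  h.1.choose_spec.continuousOn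

theorem AssumptionA1.pos {a : ℝ → ℝ} {a_min a_max : ℝ} (h : AssumptionA1 a a_min a_max)
    {x : ℝ} (hx : x ∈ Icc (0:ℝ) 1) : 0 < a x :=
  h.2.1.trans_le (h.2.2.2 x hx).1

theorem AssumptionA2'.intervalIntegrable_mul {q f : ℝ → ℝ} {ε₃ q_min : ℝ}
    (h : AssumptionA2' q ε₃ q_min) (hf : ContinuousOn f (Icc (0:ℝ) 1))
    {c d : ℝ} (hc : c ∈ Icc (0:ℝ) 1) (hd : d ∈ Icc (0:ℝ) 1) :
    IntervalIntegrable (fun x => q x * f x) volume c d := by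
  obtain ⟨Q, hQ⟩ := h.2.1
  have hq : IntervalIntegrable q volume c d := by
    refine (intervalIntegrable_const (c := Q)).mono_fun' h.1.aestronglyMeasurable ?_
    filter_upwards [ae_restrict_mem measurableSet_uIoc] with x hx
    exact hQ x (uIcc_subset_Icc hc hd (uIoc_subset_uIcc hx))
  exact hq.mul_continuousOn (hf.mono (uIcc_subset_Icc hc hd))

namespace ClassicalSolutionS

variable {a q : ℝ → ℝ} {a_min a_max ε₃ q_min α₁ α₂ β₁ γ₁ μ₁ : ℝ}
  (sol : ClassicalSolutionS a q α₁ α₂ β₁ γ₁ μ₁)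

theorem continuousOn_u :
    ContinuousOn (fun p : ℝ × ℝ => sol.u p.1 p.2) (Ici (0:ℝ) ×ˢ Icc (0:ℝ) 1) :=
  continuousOn_halfStrip_of_hasDerivAt
    (fun t ht => (sol.hu_t t ht 0 (by simp)).continuousAt.continuousWithinAt)
    sol.hu_x sol.hux_C1.continuousOn

theorem u_one_sub_eq {t : ℝ} (ht : 0 ≤ t) :
    sol.u t 1 - (sol.u 0 1 - sol.η₂ 0) = sol.η₂ t := by
  have hd : ∀ s ∈ uIcc 0 t, HasDerivAt (fun s => sol.u s 1 - sol.η₂ s) 0 s := by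
    intro s hs
    rw [uIcc_of_le ht] at hs
    have := (sol.hu_t s hs.1 1 (by simp)).sub (sol.hode2 s hs.1)
    rwa [sol.hbc1 s hs.1, sub_self] at this
  have := intervalIntegral.integral_eq_sub_of_hasDerivAt hd (by simp)
  simp only [intervalIntegral.integral_zero] at this
  linarith

theorem utt_eq {t x : ℝ} (ht : 0 < t) (hx : x ∈ Icc (0:ℝ) 1) :
    sol.utt t x = stripTimeDeriv sol.ut t x :=
  (sol.hu_tt t ht.le x hx).unique (hasDerivAt_stripTimeDeriv sol.hut_C1 ht hx)

/-- The wave equation tested against a `C¹` function on `[c,1]`. -/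
theorem integral_test {t c : ℝ} (ht : 0 < t) (hc : c ∈ Icc (0:ℝ) 1) {f f' : ℝ → ℝ}
    (hf : ∀ x ∈ Icc c 1, HasDerivWithinAt f (f' x) (Icc c 1) x)
    (hf' : ContinuousOn f' (Icc c 1)) :
    ∫ x in c..1, (f' x * (a x * sol.ux t x)
        + f x * (stripTimeDeriv sol.ut t x + q x * sol.ut t x))
      = f 1 * (a 1 * sol.ux t 1) - f c * (a c * sol.ux t c) := by
  obtain ⟨K, hK⟩ := sol.haux_lip t ht.le
  refine integral_by_parts_of_lipschitz (W := fun x => a x * sol.ux t x) hc.2 hf hf'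
    (hK.mono (Icc_subset_Icc_left hc.1)) ?_
  have hsub : Ioo c 1 ⊆ Ioo 0 1 := Ioo_subset_Ioo_left hc.1
  filter_upwards [ae_restrict_of_ae_restrict_of_subset hsub (sol.haux t ht.le),
    ae_restrict_of_ae_restrict_of_subset hsub (sol.hPDE t ht.le),
    ae_restrict_mem measurableSet_Ioo] with x h1 h2 hx
  rw [sol.utt_eq ht (Ioo_subset_Icc_self (hsub hx))] at h2
  convert h1 using 1
  linarith

theorem continuousOn_energyDensity (hA1 : AssumptionA1 a a_min a_max) :
    ContinuousOn (fun p : ℝ × ℝ => sol.ut p.1 p.2 ^ 2 + a p.2 * sol.ux p.1 p.2 ^ 2)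
      (Ici (0:ℝ) ×ˢ Icc (0:ℝ) 1) := by
  have ha : ContinuousOn (fun p : ℝ × ℝ => a p.2) (Ici (0:ℝ) ×ˢ Icc (0:ℝ) 1) :=
    hA1.continuousOn.comp continuousOn_snd fun p hp => hp.2
  exact (sol.hut_C1.continuousOn.pow 2).add (ha.mul (sol.hux_C1.continuousOn.pow 2))

/-- Dissipation of the energy. -/
theorem exists_hasDerivAt_energyS (hA1 : AssumptionA1 a a_min a_max)
    (hA2 : AssumptionA2' q ε₃ q_min) (hβ₁ : 0 < β₁) (hγ₁ : 0 < γ₁) (hμ₁ : 0 < μ₁)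
    {b : ℝ} (hb : 1 - ε₃ ≤ b) (hb1 : b ≤ 1) {t : ℝ} (ht : 0 < t) :
    ∃ E' : ℝ, HasDerivAt (energyS sol) E' t ∧
      E' ≤ -(q_min * ∫ x in b..1, sol.ut t x ^ 2) - a 1 * α₁ / β₁ * sol.η₁ t ^ 2 := by
  have h0 : (0:ℝ) ∈ Icc (0:ℝ) 1 := by simp
  have h1 : (1:ℝ) ∈ Icc (0:ℝ) 1 := by simp
  have hb' : b ∈ Icc (0:ℝ) 1 := ⟨by linarith [hA2.2.2.2.2.1], hb1⟩
  have ha : ContinuousOn (fun p : ℝ × ℝ => a p.2) (Ici (0:ℝ) ×ˢ Icc (0:ℝ) 1) :=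
    hA1.continuousOn.comp continuousOn_snd fun p hp => hp.2
  have hut := sol.hut_C1.continuousOn
  have hux := sol.hux_C1.continuousOn
  have hutt := continuousOn_stripTimeDeriv sol.hut_C1
  have huxt := continuousOn_stripTimeDeriv sol.hux_C1
  have hG : ContinuousOn (fun p : ℝ × ℝ => 2 * sol.ut p.1 p.2 * stripTimeDeriv sol.ut p.1 p.2
      + a p.2 * (2 * sol.ux p.1 p.2 * stripTimeDeriv sol.ux p.1 p.2))
      (Ici (0:ℝ) ×ˢ Icc (0:ℝ) 1) :=
    ((continuousOn_const.mul hut).mul hutt).add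
      (ha.mul ((continuousOn_const.mul hux).mul huxt))
  have hint := hasDerivAt_integral_of_continuousOn_halfStrip
    (F := fun t x => sol.ut t x ^ 2 + a x * sol.ux t x ^ 2)
    (G := fun t x => 2 * sol.ut t x * stripTimeDeriv sol.ut t x
      + a x * (2 * sol.ux t x * stripTimeDeriv sol.ux t x))
    (sol.continuousOn_energyDensity hA1) hG
    (fun s hs x hx => by
      simpa using ((hasDerivAt_stripTimeDeriv sol.hut_C1 hs hx).fun_pow 2).fun_add
        (((hasDerivAt_stripTimeDeriv sol.hux_C1 hs hx).fun_pow 2).const_mul (a x)))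
    h0 ht
  have hE := (((hint.const_mul (1/2)).add
    (((sol.hode1 t ht.le).pow 2).const_mul (a 1 / (2 * β₁)))).add
    (((sol.hode2 t ht.le).pow 2).const_mul (a 1 * α₂ / (2 * β₁)))).add
    (((sol.hode3 t ht.le).pow 2).const_mul (a 0 / (2 * μ₁)))
  refine ⟨_, hE, ?_⟩
  have hts := sol.integral_test (f := sol.ut t) (f' := stripSpaceDeriv sol.ut t) ht h0
    (fun x hx => hasDerivWithinAt_stripSpaceDeriv sol.hut_C1 ht.le hx)
    (continuousOn_slice (continuousOn_stripSpaceDeriv sol.hut_C1) ht.le)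
  have hqi : ∀ c ∈ Icc (0:ℝ) 1, ∀ d ∈ Icc (0:ℝ) 1,
      IntervalIntegrable (fun x => q x * sol.ut t x ^ 2) volume c d := fun c hc d hd =>
    hA2.intervalIntegrable_mul ((continuousOn_slice hut ht.le).pow 2) hc hd
  have hsplit : ∫ x in (0:ℝ)..1, (stripSpaceDeriv sol.ut t x * (a x * sol.ux t x)
        + sol.ut t x * (stripTimeDeriv sol.ut t x + q x * sol.ut t x))
      = (∫ x in (0:ℝ)..1, (1/2) * (2 * sol.ut t x * stripTimeDeriv sol.ut t x
          + a x * (2 * sol.ux t x * stripTimeDeriv sol.ux t x)))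
        + ∫ x in (0:ℝ)..1, q x * sol.ut t x ^ 2 := by
    have hGt := continuousOn_slice (F := fun t x => 2 * sol.ut t x * stripTimeDeriv sol.ut t x
      + a x * (2 * sol.ux t x * stripTimeDeriv sol.ux t x)) hG ht.le
    rw [← intervalIntegral.integral_add
      ((intervalIntegrable_of_continuousOn_unit hGt h0 h1).const_mul (1/2)) (hqi 0 h0 1 h1)]
    refine intervalIntegral.integral_congr_Ioo_of_le zero_le_one fun x hx => ?_
    simp only [stripSpaceDeriv_eq_stripTimeDeriv sol.hu_t sol.hu_x sol.hut_C1 sol.hux_C1 ht hx]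
    ring
  rw [hts, intervalIntegral.integral_const_mul] at hsplit
  have hqb : q_min * (∫ x in b..1, sol.ut t x ^ 2) ≤ ∫ x in (0:ℝ)..1, q x * sol.ut t x ^ 2 := by
    rw [← intervalIntegral.integral_add_adjacent_intervals (hqi 0 h0 b hb') (hqi b hb' 1 h1),
      ← intervalIntegral.integral_const_mul]
    have hpos : 0 ≤ ∫ x in (0:ℝ)..b, q x * sol.ut t x ^ 2 := by
      rw [intervalIntegral.integral_of_le hb'.1, integral_Ioc_eq_integral_Ioo]
      refine integral_nonneg_of_ae ?_
      filter_upwards [ae_restrict_of_ae_restrict_of_subset (Ioo_subset_Ioo_right hb1)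
        hA2.2.2.1] with x hx
      exact mul_nonneg hx (sq_nonneg _)
    have hle : ∫ x in b..1, q_min * sol.ut t x ^ 2 ≤ ∫ x in b..1, q x * sol.ut t x ^ 2 := by
      rw [intervalIntegral.integral_of_le hb1, intervalIntegral.integral_of_le hb1,
        integral_Ioc_eq_integral_Ioo, integral_Ioc_eq_integral_Ioo]
      refine integral_mono_ae ?_ ?_ ?_
      · exact (((intervalIntegrable_of_continuousOn_unit
          ((continuousOn_slice hut ht.le).pow 2) hb' h1).const_mul q_min).1).mono_set
            Ioo_subset_Ioc_self
      · exact ((hqi b hb' 1 h1).1).mono_set Ioo_subset_Ioc_self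
      · filter_upwards [ae_restrict_of_ae_restrict_of_subset (Ioo_subset_Ioo_left hb)
          hA2.2.2.2.2.2.2] with x hx
        exact mul_le_mul_of_nonneg_right hx (sq_nonneg _)
    linarith
  rw [sol.hbc1 t ht.le, sol.hbc0 t ht.le] at hsplit
  have hζ : 0 ≤ a 0 * γ₁ / μ₁ * sol.ζ₁ t ^ 2 := by
    have := hA1.pos h0
    positivity
  have e1 : a 1 / (2 * β₁) * (2 * sol.η₁ t * (-α₁ * sol.η₁ t - α₂ * sol.η₂ t - β₁ * sol.ux t 1))
      + a 1 * α₂ / (2 * β₁) * (2 * sol.η₂ t * sol.η₁ t)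
      = - (a 1 * α₁ / β₁ * sol.η₁ t ^ 2) - sol.η₁ t * (a 1 * sol.ux t 1) := by
    field_simp
    ring
  have e0 : a 0 / (2 * μ₁) * (2 * sol.ζ₁ t * (-γ₁ * sol.ζ₁ t + μ₁ * sol.ux t 0))
      = - (a 0 * γ₁ / μ₁ * sol.ζ₁ t ^ 2) + sol.ζ₁ t * (a 0 * sol.ux t 0) := by
    field_simp
  norm_num at e1 e0 hsplit ⊢
  linarith

end ClassicalSolutionS

namespace ClassicalSolutionS

variable {a q : ℝ → ℝ} {a_min a_max ε₃ q_min α₁ α₂ β₁ γ₁ μ₁ : ℝ}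
  (sol : ClassicalSolutionS a q α₁ α₂ β₁ γ₁ μ₁)

/-- The displacement relative to its conserved reference value. -/
def displacement (t x : ℝ) : ℝ := sol.u t x - (sol.u 0 1 - sol.η₂ 0)

/-- The multiplier functional `∫_b^1 (x - b)² v u_t` with the boundary terms it generates. -/
noncomputable def multiplierFunctional (b t : ℝ) : ℝ :=
  (∫ x in b..1, (x - b) ^ 2 * sol.displacement t x * sol.ut t x)
    + (1 - b) ^ 2 * a 1 / β₁ * (sol.η₁ t * sol.η₂ t + α₁ / 2 * sol.η₂ t ^ 2)

theorem continuousOn_displacement :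
    ContinuousOn (fun p : ℝ × ℝ => sol.displacement p.1 p.2) (Ici (0:ℝ) ×ˢ Icc (0:ℝ) 1) :=
  sol.continuousOn_u.sub continuousOn_const

theorem hasDerivAt_displacement_time {t x : ℝ} (ht : 0 ≤ t) (hx : x ∈ Icc (0:ℝ) 1) :
    HasDerivAt (fun s => sol.displacement s x) (sol.ut t x) t :=
  (sol.hu_t t ht x hx).sub_const _

theorem hasDerivAt_displacement_space {t x : ℝ} (ht : 0 ≤ t) (hx : x ∈ Icc (0:ℝ) 1) :
    HasDerivAt (sol.displacement t) (sol.ux t x) x :=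
  (sol.hu_x t ht x hx).sub_const _

theorem displacement_one {t : ℝ} (ht : 0 ≤ t) : sol.displacement t 1 = sol.η₂ t :=
  sol.u_one_sub_eq ht

theorem continuousOn_multiplier_integrand (b : ℝ) :
    ContinuousOn (fun p : ℝ × ℝ => (p.2 - b) ^ 2 * sol.displacement p.1 p.2 * sol.ut p.1 p.2)
      (Ici (0:ℝ) ×ˢ Icc (0:ℝ) 1) := by
  have hw : ContinuousOn (fun p : ℝ × ℝ => (p.2 - b) ^ 2) (Ici (0:ℝ) ×ˢ Icc (0:ℝ) 1) := by
    fun_prop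
  exact (hw.mul sol.continuousOn_displacement).mul sol.hut_C1.continuousOn

theorem continuousOn_multiplierFunctional {b : ℝ} (hb : b ∈ Icc (0:ℝ) 1) :
    ContinuousOn (sol.multiplierFunctional b) (Ici (0:ℝ)) := by
  have h₁ := sol.hη₁C1.continuousOn
  have h₂ := sol.hη₂C1.continuousOn
  exact (continuousOn_integral_of_continuousOn_halfStrip
      (F := fun t x => (x - b) ^ 2 * sol.displacement t x * sol.ut t x)
      (sol.continuousOn_multiplier_integrand b) hb).add
    (continuousOn_const.mul ((h₁.mul h₂).add (continuousOn_const.mul (h₂.pow 2))))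

theorem continuousOn_energyS (hA1 : AssumptionA1 a a_min a_max) :
    ContinuousOn (energyS sol) (Ici (0:ℝ)) := by
  have h := continuousOn_integral_of_continuousOn_halfStrip
    (F := fun t x => sol.ut t x ^ 2 + a x * sol.ux t x ^ 2)
    (sol.continuousOn_energyDensity hA1) (c := 0) (by simp)
  exact (((continuousOn_const.mul h).add
    (continuousOn_const.mul (sol.hη₁C1.continuousOn.pow 2))).add
    (continuousOn_const.mul (sol.hη₂C1.continuousOn.pow 2))).add
    (continuousOn_const.mul (sol.hζ₁C1.continuousOn.pow 2))

theorem exists_hasDerivAt_multiplierFunctional (hA1 : AssumptionA1 a a_min a_max)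
    (hA2 : AssumptionA2' q ε₃ q_min) (hβ₁ : 0 < β₁)
    {Q : ℝ} (hQ : ∀ x ∈ Icc (0:ℝ) 1, |q x| ≤ Q)
    {b : ℝ} (hb : b ∈ Icc (0:ℝ) 1) {t : ℝ} (ht : 0 < t) :
    ∃ Ψ' : ℝ, HasDerivAt (sol.multiplierFunctional b) Ψ' t ∧
      Ψ' ≤ (1 + Q / 2) * (∫ x in b..1, sol.ut t x ^ 2)
        + (1 - b) ^ 2 * a 1 / β₁ * sol.η₁ t ^ 2
        - (1 - b) ^ 2 * a 1 * α₂ / β₁ * sol.η₂ t ^ 2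
        - (1 / 2) * (∫ x in b..1, (x - b) ^ 2 * (a x * sol.ux t x ^ 2))
        + (2 * a_max + Q / 2) * ∫ x in b..1, sol.displacement t x ^ 2 := by
  have h1 : (1:ℝ) ∈ Icc (0:ℝ) 1 := by simp
  have hsub : Icc b 1 ⊆ Icc (0:ℝ) 1 := Icc_subset_Icc_left hb.1
  have hut := sol.hut_C1.continuousOn
  have hutt := continuousOn_stripTimeDeriv sol.hut_C1
  have hw : ContinuousOn (fun p : ℝ × ℝ => (p.2 - b) ^ 2) (Ici (0:ℝ) ×ˢ Icc (0:ℝ) 1) := by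
    fun_prop
  have hv := sol.continuousOn_displacement
  have hint := hasDerivAt_integral_of_continuousOn_halfStrip
    (F := fun t x => (x - b) ^ 2 * sol.displacement t x * sol.ut t x)
    (G := fun t x => (x - b) ^ 2 * sol.ut t x * sol.ut t x
      + (x - b) ^ 2 * sol.displacement t x * stripTimeDeriv sol.ut t x)
    (sol.continuousOn_multiplier_integrand b)
    (((hw.mul hut).mul hut).add ((hw.mul hv).mul hutt))
    (fun s hs x hx => ((sol.hasDerivAt_displacement_time hs.le hx).const_mul _).fun_mul
      (hasDerivAt_stripTimeDeriv sol.hut_C1 hs hx)) hb ht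
  have hΨ := hint.add ((((sol.hode1 t ht.le).fun_mul (sol.hode2 t ht.le)).add
    (((sol.hode2 t ht.le).fun_pow 2).const_mul (α₁ / 2))).const_mul ((1 - b) ^ 2 * a 1 / β₁))
  refine ⟨_, hΨ, ?_⟩
  have hatx := hA1.continuousOn
  have hutx := continuousOn_slice hut ht.le
  have huxx := continuousOn_slice sol.hux_C1.continuousOn ht.le
  have huttx := continuousOn_slice hutt ht.le
  have hvx := continuousOn_slice hv ht.le
  have hl : ContinuousOn (fun x : ℝ => x - b) (Icc (0:ℝ) 1) := by fun_prop
  have hf' : ContinuousOn (fun x => 2 * (x - b) * sol.displacement t x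
      + (x - b) ^ 2 * sol.ux t x) (Icc (0:ℝ) 1) :=
    ((continuousOn_const.mul hl).mul hvx).add ((hl.pow 2).mul huxx)
  have hts := sol.integral_test (f := fun x => (x - b) ^ 2 * sol.displacement t x)
    (f' := fun x => 2 * (x - b) * sol.displacement t x + (x - b) ^ 2 * sol.ux t x) ht hb
    (fun x hx => by
      simpa using (((hasDerivAt_id x).sub_const b).fun_pow 2).fun_mul
        (sol.hasDerivAt_displacement_space ht.le (hsub hx)) |>.hasDerivWithinAt)
    (hf'.mono hsub)
  simp only [sub_self, ne_eq, OfNat.ofNat_ne_zero, not_false_eq_true, zero_pow, zero_mul,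
    sub_zero, sol.displacement_one ht.le] at hts
  have iR : IntervalIntegrable (fun x => (2 * (x - b) * sol.displacement t x
        + (x - b) ^ 2 * sol.ux t x) * (a x * sol.ux t x)
      + (x - b) ^ 2 * sol.displacement t x
        * (stripTimeDeriv sol.ut t x + q x * sol.ut t x)) volume b 1 := by
    have i1 := intervalIntegrable_of_continuousOn_unit
      ((hf'.mul (hatx.mul huxx)).add (((hl.pow 2).mul hvx).mul huttx)) hb h1
    have i2 := hA2.intervalIntegrable_mul (((hl.pow 2).mul hvx).mul hutx) hb h1
    refine (i1.add i2).congr fun x _ => ?_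
    simp only [Pi.add_apply, Pi.mul_apply, Pi.pow_apply]
    ring
  have iA : IntervalIntegrable (fun x => sol.ut t x ^ 2) volume b 1 :=
    intervalIntegrable_of_continuousOn_unit (hutx.pow 2) hb h1
  have iV : IntervalIntegrable (fun x => sol.displacement t x ^ 2) volume b 1 :=
    intervalIntegrable_of_continuousOn_unit (hvx.pow 2) hb h1
  have iX : IntervalIntegrable (fun x => (x - b) ^ 2 * (a x * sol.ux t x ^ 2)) volume b 1 :=
    intervalIntegrable_of_continuousOn_unit
    ((hl.pow 2).mul (hatx.mul (huxx.pow 2))) hb h1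
  have iG := intervalIntegrable_of_continuousOn_unit
    ((((hl.pow 2).mul hutx).mul hutx).add (((hl.pow 2).mul hvx).mul huttx)) hb h1
  have hmono : (∫ x in b..1, ((x - b) ^ 2 * sol.ut t x * sol.ut t x
        + (x - b) ^ 2 * sol.displacement t x * stripTimeDeriv sol.ut t x))
      ≤ ∫ x in b..1, (((2 * (x - b) * sol.displacement t x
        + (x - b) ^ 2 * sol.ux t x) * (a x * sol.ux t x)
      + (x - b) ^ 2 * sol.displacement t x
        * (stripTimeDeriv sol.ut t x + q x * sol.ut t x))
      + ((1 + Q / 2) * sol.ut t x ^ 2 + ((-(1 / 2)) * ((x - b) ^ 2 * (a x * sol.ux t x ^ 2))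
        + (2 * a_max + Q / 2) * sol.displacement t x ^ 2))) := by
    refine intervalIntegral.integral_mono_on hb.2 iG
      (iR.add ((iA.const_mul _).add ((iX.const_mul _).add (iV.const_mul _)))) fun x hx => ?_
    have hx' := hsub hx
    obtain ⟨-, ha2⟩ := hA1.2.2.2 x hx'
    have hapos := hA1.pos hx'
    have hq := hQ x hx'
    have hw0 : 0 ≤ (x - b) ^ 2 := sq_nonneg _
    have hw1 : (x - b) ^ 2 ≤ 1 := by nlinarith [hx.1, hx'.2, hb.1]
    generalize sol.displacement t x = v
    generalize sol.ut t x = y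
    generalize sol.ux t x = z
    have h₁ : -(2 * (x - b) * v * (a x * z))
        ≤ 1 / 2 * ((x - b) ^ 2 * (a x * z ^ 2)) + 2 * a_max * v ^ 2 := by
      nlinarith [mul_nonneg hapos.le (sq_nonneg ((x - b) * z + 2 * v)),
        mul_nonneg (sub_nonneg.2 ha2) (sq_nonneg v)]
    have h₂ : -((x - b) ^ 2 * v * (q x * y)) ≤ Q / 2 * y ^ 2 + Q / 2 * v ^ 2 := by
      have e : |(x - b) ^ 2 * q x| ≤ Q := by
        rw [abs_mul, abs_of_nonneg hw0]
        nlinarith [abs_nonneg (q x)]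
      obtain ⟨e1, e2⟩ := abs_le.1 e
      nlinarith [mul_nonneg (sub_nonneg.2 e2) (sq_nonneg (v - y)),
        mul_nonneg (neg_le_iff_add_nonneg.1 e1) (sq_nonneg (v + y))]
    have h₃ : (x - b) ^ 2 * y * y ≤ y ^ 2 := by nlinarith [sq_nonneg y]
    linarith
  rw [intervalIntegral.integral_add iR
      ((iA.const_mul _).add ((iX.const_mul _).add (iV.const_mul _))), hts,
    intervalIntegral.integral_add (iA.const_mul _) ((iX.const_mul _).add (iV.const_mul _)),
    intervalIntegral.integral_add (iX.const_mul _) (iV.const_mul _),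
    intervalIntegral.integral_const_mul, intervalIntegral.integral_const_mul,
    intervalIntegral.integral_const_mul] at hmono
  have e : (1 - b) ^ 2 * a 1 / β₁ *
      ((-α₁ * sol.η₁ t - α₂ * sol.η₂ t - β₁ * sol.ux t 1) * sol.η₂ t + sol.η₁ t * sol.η₁ t
        + α₁ / 2 * (2 * sol.η₂ t * sol.η₁ t))
      = (1 - b) ^ 2 * a 1 / β₁ * sol.η₁ t ^ 2
        - (1 - b) ^ 2 * a 1 * α₂ / β₁ * sol.η₂ t ^ 2
        - (1 - b) ^ 2 * sol.η₂ t * (a 1 * sol.ux t 1) := by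
    field_simp
    ring
  norm_num at e hmono ⊢
  linarith

theorem energyS_bounds (hA1 : AssumptionA1 a a_min a_max) (hα₂ : 0 < α₂) (hβ₁ : 0 < β₁)
    (hμ₁ : 0 < μ₁) {t : ℝ} (ht : 0 ≤ t) :
    (∫ x in (0:ℝ)..1, sol.ut t x ^ 2) ≤ 2 * energyS sol t ∧
    (∫ x in (0:ℝ)..1, a x * sol.ux t x ^ 2) ≤ 2 * energyS sol t ∧
    a 1 / (2 * β₁) * sol.η₁ t ^ 2 ≤ energyS sol t ∧
    a 1 * α₂ / (2 * β₁) * sol.η₂ t ^ 2 ≤ energyS sol t := by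
  have h0 : (0:ℝ) ∈ Icc (0:ℝ) 1 := by simp
  have h1 : (1:ℝ) ∈ Icc (0:ℝ) 1 := by simp
  have hutx := continuousOn_slice sol.hut_C1.continuousOn ht
  have huxx := continuousOn_slice sol.hux_C1.continuousOn ht
  have i1 : IntervalIntegrable (fun x => sol.ut t x ^ 2) volume 0 1 :=
    intervalIntegrable_of_continuousOn_unit (hutx.pow 2) h0 h1
  have i2 : IntervalIntegrable (fun x => a x * sol.ux t x ^ 2) volume 0 1 :=
    intervalIntegrable_of_continuousOn_unit
    (hA1.continuousOn.mul (huxx.pow 2)) h0 h1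
  have hE : energyS sol t = (1/2) * ((∫ x in (0:ℝ)..1, sol.ut t x ^ 2)
      + ∫ x in (0:ℝ)..1, a x * sol.ux t x ^ 2)
    + (a 1 / (2 * β₁)) * sol.η₁ t ^ 2
    + (a 1 * α₂ / (2 * β₁)) * sol.η₂ t ^ 2
    + (a 0 / (2 * μ₁)) * sol.ζ₁ t ^ 2 := by
    rw [energyS, intervalIntegral.integral_add i1 i2]
  have p1 : 0 ≤ ∫ x in (0:ℝ)..1, sol.ut t x ^ 2 :=
    intervalIntegral.integral_nonneg zero_le_one fun x _ => sq_nonneg _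
  have p2 : 0 ≤ ∫ x in (0:ℝ)..1, a x * sol.ux t x ^ 2 :=
    intervalIntegral.integral_nonneg zero_le_one fun x hx =>
      mul_nonneg (hA1.pos hx).le (sq_nonneg _)
  have ha1 := hA1.pos h1
  have ha0 := hA1.pos h0
  have p3 : 0 ≤ a 1 / (2 * β₁) * sol.η₁ t ^ 2 := by positivity
  have p4 : 0 ≤ a 1 * α₂ / (2 * β₁) * sol.η₂ t ^ 2 := by positivity
  have p5 : 0 ≤ a 0 / (2 * μ₁) * sol.ζ₁ t ^ 2 := by positivity
  refine ⟨?_, ?_, ?_, ?_⟩ <;> linarith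

theorem displacement_sq_le (hA1 : AssumptionA1 a a_min a_max) (hα₂ : 0 < α₂) (hβ₁ : 0 < β₁)
    (hμ₁ : 0 < μ₁) {t x : ℝ} (ht : 0 ≤ t) (hx : x ∈ Icc (0:ℝ) 1) :
    sol.displacement t x ^ 2 ≤ (4 * β₁ / (a 1 * α₂) + 4 / a_min) * energyS sol t := by
  have h1 : (1:ℝ) ∈ Icc (0:ℝ) 1 := by simp
  have h0 : (0:ℝ) ∈ Icc (0:ℝ) 1 := by simp
  have hamin := hA1.2.1
  obtain ⟨-, hX, -, hη⟩ := sol.energyS_bounds hA1 hα₂ hβ₁ hμ₁ ht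
  have huxx := continuousOn_slice sol.hux_C1.continuousOn ht
  have hsub : Icc x 1 ⊆ Icc (0:ℝ) 1 := Icc_subset_Icc_left hx.1
  have hftc := intervalIntegral.integral_eq_sub_of_hasDerivAt (a := x) (b := 1)
    (f := sol.displacement t) (f' := sol.ux t)
    (fun y hy => sol.hasDerivAt_displacement_space ht (uIcc_subset_Icc hx h1 hy))
    (intervalIntegrable_of_continuousOn_unit huxx hx h1)
  rw [sol.displacement_one ht] at hftc
  have hcs := sq_integral_le_integral_sq hx.2 (by linarith [hx.1]) (huxx.mono hsub)
  have hle : a_min * (∫ y in x..1, sol.ux t y ^ 2) ≤ ∫ y in (0:ℝ)..1, a y * sol.ux t y ^ 2 := by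
    have i2 := intervalIntegrable_of_continuousOn_unit (hA1.continuousOn.mul (huxx.pow 2)) h0 h1
    calc a_min * (∫ y in x..1, sol.ux t y ^ 2)
        = ∫ y in x..1, a_min * sol.ux t y ^ 2 :=
          (intervalIntegral.integral_const_mul _ _).symm
      _ ≤ ∫ y in x..1, a y * sol.ux t y ^ 2 :=
          intervalIntegral.integral_mono_on hx.2
            ((intervalIntegrable_of_continuousOn_unit (huxx.pow 2) hx h1).const_mul _)
            (intervalIntegrable_of_continuousOn_unit (hA1.continuousOn.mul (huxx.pow 2)) hx h1)
            fun y hy => mul_le_mul_of_nonneg_right (hA1.2.2.2 y (hsub hy)).1 (sq_nonneg _)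
      _ ≤ ∫ y in (0:ℝ)..1, a y * sol.ux t y ^ 2 := by
          refine intervalIntegral.integral_mono_interval hx.1 hx.2 le_rfl ?_ i2
          filter_upwards [ae_restrict_mem measurableSet_Ioc] with y hy
          exact mul_nonneg (hA1.pos (Ioc_subset_Icc_self hy)).le (sq_nonneg _)
  have hux : (∫ y in x..1, sol.ux t y ^ 2) ≤ 2 * energyS sol t / a_min := by
    rw [le_div_iff₀ hamin]
    linarith
  have ha1 := hA1.pos h1
  have hη' : sol.η₂ t ^ 2 ≤ 2 * β₁ / (a 1 * α₂) * energyS sol t := by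
    calc sol.η₂ t ^ 2 = 2 * β₁ / (a 1 * α₂) * (a 1 * α₂ / (2 * β₁) * sol.η₂ t ^ 2) := by
          field_simp
      _ ≤ _ := by gcongr
  have : sol.displacement t x = sol.η₂ t - ∫ y in x..1, sol.ux t y := by linarith
  rw [this]
  calc (sol.η₂ t - ∫ y in x..1, sol.ux t y) ^ 2
      ≤ 2 * sol.η₂ t ^ 2 + 2 * (∫ y in x..1, sol.ux t y) ^ 2 := by
        nlinarith [sq_nonneg (sol.η₂ t + ∫ y in x..1, sol.ux t y)]
    _ ≤ 2 * (2 * β₁ / (a 1 * α₂) * energyS sol t) + 2 * (2 * energyS sol t / a_min) := by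
        linarith
    _ = _ := by ring

theorem abs_multiplierFunctional_le (hA1 : AssumptionA1 a a_min a_max) (hα₁ : 0 < α₁)
    (hα₂ : 0 < α₂) (hβ₁ : 0 < β₁) (hμ₁ : 0 < μ₁) {b : ℝ} (hb : b ∈ Icc (0:ℝ) 1)
    {t : ℝ} (ht : 0 ≤ t) :
    |sol.multiplierFunctional b t| ≤
      (2 * β₁ / (a 1 * α₂) + 2 / a_min + 2 + (1 + α₁) / α₂) * energyS sol t := by
  have h1 : (1:ℝ) ∈ Icc (0:ℝ) 1 := by simp
  have h0 : (0:ℝ) ∈ Icc (0:ℝ) 1 := by simp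
  obtain ⟨hA, -, hη₁, hη₂⟩ := sol.energyS_bounds hA1 hα₂ hβ₁ hμ₁ ht
  have hsub : Icc b 1 ⊆ Icc (0:ℝ) 1 := Icc_subset_Icc_left hb.1
  have hutx := continuousOn_slice sol.hut_C1.continuousOn ht
  have iA : IntervalIntegrable (fun x => sol.ut t x ^ 2) volume b 1 :=
    intervalIntegrable_of_continuousOn_unit (hutx.pow 2) hb h1
  have ha1 := hA1.pos h1
  have hb2 : (1 - b) ^ 2 ≤ 1 := by nlinarith [hb.1, hb.2]
  set M := (4 * β₁ / (a 1 * α₂) + 4 / a_min) * energyS sol t with hM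
  have hM0 : 0 ≤ M := (sq_nonneg _).trans (sol.displacement_sq_le hA1 hα₂ hβ₁ hμ₁ ht h1)
  have hbulk : |∫ x in b..1, (x - b) ^ 2 * sol.displacement t x * sol.ut t x|
      ≤ M / 2 + energyS sol t := by
    have hAb : (∫ x in b..1, sol.ut t x ^ 2) ≤ ∫ x in (0:ℝ)..1, sol.ut t x ^ 2 :=
      intervalIntegral.integral_mono_interval hb.1 hb.2 le_rfl
        (Filter.Eventually.of_forall fun x => sq_nonneg _)
        (intervalIntegrable_of_continuousOn_unit (hutx.pow 2) h0 h1)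
    calc |∫ x in b..1, (x - b) ^ 2 * sol.displacement t x * sol.ut t x|
        ≤ ∫ x in b..1, |(x - b) ^ 2 * sol.displacement t x * sol.ut t x| :=
          intervalIntegral.abs_integral_le_integral_abs hb.2
      _ ≤ ∫ x in b..1, (M / 2 + (1 / 2) * sol.ut t x ^ 2) := by
          refine intervalIntegral.integral_mono_on hb.2
            (intervalIntegrable_of_continuousOn_unit (continuousOn_slice
              (F := fun t x => (x - b) ^ 2 * sol.displacement t x * sol.ut t x)
              (sol.continuousOn_multiplier_integrand b) ht) hb h1).abs
            (intervalIntegrable_const.add (iA.const_mul _)) fun x hx => ?_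
          have hv := sol.displacement_sq_le hA1 hα₂ hβ₁ hμ₁ ht (hsub hx)
          have hw1 : (x - b) ^ 2 ≤ 1 := by nlinarith [hx.1, hx.2, hb.1]
          rw [mul_assoc, abs_mul, abs_of_nonneg (sq_nonneg (x - b)), abs_mul]
          have : |sol.displacement t x| * |sol.ut t x| ≤ M / 2 + 1 / 2 * sol.ut t x ^ 2 := by
            nlinarith [sq_nonneg (|sol.displacement t x| - |sol.ut t x|),
              sq_abs (sol.displacement t x), sq_abs (sol.ut t x)]
          exact (mul_le_of_le_one_left (by positivity) hw1).trans this
      _ = (1 - b) * (M / 2) + 1 / 2 * ∫ x in b..1, sol.ut t x ^ 2 := by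
          rw [intervalIntegral.integral_add intervalIntegrable_const (iA.const_mul _),
            intervalIntegral.integral_const_mul, intervalIntegral.integral_const, smul_eq_mul]
      _ ≤ M / 2 + energyS sol t := by
          have : 0 ≤ b * (M / 2) := mul_nonneg hb.1 (by positivity)
          linarith
  have hbdry : |(1 - b) ^ 2 * a 1 / β₁ * (sol.η₁ t * sol.η₂ t + α₁ / 2 * sol.η₂ t ^ 2)|
      ≤ (1 + (1 + α₁) / α₂) * energyS sol t := by
    have e1 : |sol.η₁ t * sol.η₂ t + α₁ / 2 * sol.η₂ t ^ 2|
        ≤ 1 / 2 * sol.η₁ t ^ 2 + (1 + α₁) / 2 * sol.η₂ t ^ 2 := by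
      rw [abs_le]
      constructor <;>
      nlinarith [sq_nonneg (sol.η₁ t + sol.η₂ t), sq_nonneg (sol.η₁ t - sol.η₂ t),
        mul_nonneg hα₁.le (sq_nonneg (sol.η₂ t))]
    have e2 : (1 - b) ^ 2 * a 1 / β₁ ≤ a 1 / β₁ := by
      gcongr
      exact mul_le_of_le_one_left ha1.le hb2
    rw [abs_mul, abs_of_nonneg (by positivity)]
    calc _ ≤ a 1 / β₁ * (1 / 2 * sol.η₁ t ^ 2 + (1 + α₁) / 2 * sol.η₂ t ^ 2) := by gcongr
      _ = a 1 / (2 * β₁) * sol.η₁ t ^ 2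
          + (1 + α₁) / α₂ * (a 1 * α₂ / (2 * β₁) * sol.η₂ t ^ 2) := by
        field_simp
      _ ≤ energyS sol t + (1 + α₁) / α₂ * energyS sol t := by gcongr
      _ = _ := by ring
  calc |sol.multiplierFunctional b t| ≤ _ := abs_add_le _ _
    _ ≤ _ := add_le_add hbulk hbdry
    _ = _ := by rw [hM]; ring

end ClassicalSolutionS

namespace ClassicalSolutionS

variable {a q : ℝ → ℝ} {a_min a_max ε₁ ε₂ ε₃ q_min α₁ α₂ β₁ γ₁ μ₁ : ℝ}
  (sol : ClassicalSolutionS a q α₁ α₂ β₁ γ₁ μ₁)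

theorem energyS_nonneg (hA1 : AssumptionA1 a a_min a_max) (hα₂ : 0 < α₂) (hβ₁ : 0 < β₁)
    (hμ₁ : 0 < μ₁) {t : ℝ} (ht : 0 ≤ t) : 0 ≤ energyS sol t := by
  have ha1 := hA1.pos (show (1:ℝ) ∈ Icc (0:ℝ) 1 by simp)
  have hη₁ := (sol.energyS_bounds hA1 hα₂ hβ₁ hμ₁ ht).2.2.1
  exact le_trans (by positivity) hη₁

theorem energyS_le_of_le (hA1 : AssumptionA1 a a_min a_max) (hA2 : AssumptionA2' q ε₃ q_min)
    (hα₁ : 0 < α₁) (hβ₁ : 0 < β₁) (hγ₁ : 0 < γ₁) (hμ₁ : 0 < μ₁) {s t : ℝ} (hs : 0 ≤ s)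
    (hst : s ≤ t) : energyS sol t ≤ energyS sol s := by
  have ha1 := hA1.pos (show (1:ℝ) ∈ Icc (0:ℝ) 1 by simp)
  choose! E' hE' hE'le using fun r (hr : 0 < r) =>
    sol.exists_hasDerivAt_energyS hA1 hA2 hβ₁ hγ₁ hμ₁ (b := 1)
      (by linarith [hA2.2.2.2.1]) le_rfl hr
  refine antitoneOn_of_hasDerivWithinAt_nonpos (f' := E') (convex_Ici (0:ℝ))
    (sol.continuousOn_energyS hA1) (fun r hr => ?_) (fun r hr => ?_) hs (hs.trans hst) hst
  · rw [interior_Ici] at hr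
    exact (hE' r hr).hasDerivWithinAt
  · rw [interior_Ici] at hr
    refine (hE'le r hr).trans ?_
    have : 0 ≤ a 1 * α₁ / β₁ * sol.η₁ r ^ 2 := by positivity
    simpa using this

/-- Adding a multiple of the energy to the multiplier functional absorbs the velocity terms. -/
theorem exists_hasDerivAt_lyapunov (hA1 : AssumptionA1 a a_min a_max)
    (hA2 : AssumptionA2' q ε₃ q_min) (hε₁ : 0 < ε₁) (hε₁₂ : ε₁ < ε₂) (hε₂₃ : ε₂ < ε₃)
    (hα₁ : 0 < α₁) (hβ₁ : 0 < β₁) (hγ₁ : 0 < γ₁) (hμ₁ : 0 < μ₁)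
    {Q : ℝ} (hQ : ∀ x ∈ Icc (0:ℝ) 1, |q x| ≤ Q)
    {κ : ℝ} (hκ₁ : κ ≤ 1) (hκ₂ : κ ≤ ε₂ ^ 2 * a 1 * α₂ / β₁) (hκ₃ : κ ≤ (ε₂ - ε₁) ^ 2 / 2)
    {t : ℝ} (ht : 0 < t) :
    ∃ Φ' : ℝ, HasDerivAt (fun s => sol.multiplierFunctional (1 - ε₂) s
        + ((2 + Q / 2) / q_min + 1 / α₁) * energyS sol s) Φ' t ∧
      Φ' ≤ (-κ) * ((∫ x in (1 - ε₁)..1, (sol.ut t x ^ 2 + a x * sol.ux t x ^ 2)) + sol.η₂ t ^ 2)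
        + (2 * a_max + Q / 2) * ∫ x in (1 - ε₂)..1, sol.displacement t x ^ 2 := by
  have h1 : (1:ℝ) ∈ Icc (0:ℝ) 1 := by simp
  have hε₃1 := hA2.2.2.2.2.1
  have hqm := hA2.2.2.2.2.2.1
  have hb : 1 - ε₂ ∈ Icc (0:ℝ) 1 := ⟨by linarith, by linarith⟩
  have hb₁ : 1 - ε₁ ∈ Icc (0:ℝ) 1 := ⟨by linarith, by linarith⟩
  have ha1 := hA1.pos h1
  have hQ0 : 0 ≤ Q := (abs_nonneg _).trans (hQ 1 h1)
  obtain ⟨Ψ', hΨ, hΨle⟩ := sol.exists_hasDerivAt_multiplierFunctional hA1 hA2 hβ₁ hQ hb ht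
  obtain ⟨E', hE, hEle⟩ := sol.exists_hasDerivAt_energyS hA1 hA2 hβ₁ hγ₁ hμ₁
    (b := 1 - ε₂) (by linarith) hb.2 ht
  refine ⟨_, hΨ.fun_add (hE.const_mul _), ?_⟩
  have hutx := continuousOn_slice sol.hut_C1.continuousOn ht.le
  have huxx := continuousOn_slice sol.hux_C1.continuousOn ht.le
  have hX := hA1.continuousOn.mul (huxx.pow 2)
  have iA : ∀ c ∈ Icc (0:ℝ) 1, IntervalIntegrable (fun x => sol.ut t x ^ 2) volume c 1 :=
    fun c hc => intervalIntegrable_of_continuousOn_unit (hutx.pow 2) hc h1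
  have iX : ∀ c ∈ Icc (0:ℝ) 1,
      IntervalIntegrable (fun x => a x * sol.ux t x ^ 2) volume c 1 :=
    fun c hc => intervalIntegrable_of_continuousOn_unit hX hc h1
  have hw : ContinuousOn (fun x : ℝ => (x - (1 - ε₂)) ^ 2) (Icc (0:ℝ) 1) := by fun_prop
  have iW : ∀ c ∈ Icc (0:ℝ) 1, IntervalIntegrable
      (fun x => (x - (1 - ε₂)) ^ 2 * (a x * sol.ux t x ^ 2)) volume c 1 :=
    fun c hc => intervalIntegrable_of_continuousOn_unit (hw.mul hX) hc h1
  have hA : (∫ x in (1 - ε₁)..1, sol.ut t x ^ 2) ≤ ∫ x in (1 - ε₂)..1, sol.ut t x ^ 2 :=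
    intervalIntegral.integral_mono_interval (by linarith) hb₁.2 le_rfl
      (Filter.Eventually.of_forall fun x => sq_nonneg _) (iA _ hb)
  have hA0 : 0 ≤ ∫ x in (1 - ε₂)..1, sol.ut t x ^ 2 :=
    intervalIntegral.integral_nonneg hb.2 fun x _ => sq_nonneg _
  have hA0' : 0 ≤ ∫ x in (1 - ε₁)..1, sol.ut t x ^ 2 :=
    intervalIntegral.integral_nonneg hb₁.2 fun x _ => sq_nonneg _
  have hX0 : 0 ≤ ∫ x in (1 - ε₁)..1, a x * sol.ux t x ^ 2 :=
    intervalIntegral.integral_nonneg hb₁.2 fun x hx =>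
      mul_nonneg (hA1.pos ⟨hb₁.1.trans hx.1, hx.2⟩).le (sq_nonneg _)
  have hW : (ε₂ - ε₁) ^ 2 * (∫ x in (1 - ε₁)..1, a x * sol.ux t x ^ 2)
      ≤ ∫ x in (1 - ε₂)..1, (x - (1 - ε₂)) ^ 2 * (a x * sol.ux t x ^ 2) := by
    rw [← intervalIntegral.integral_const_mul]
    refine (intervalIntegral.integral_mono_on hb₁.2 ((iX _ hb₁).const_mul _) (iW _ hb₁)
      fun x hx => ?_).trans (intervalIntegral.integral_mono_interval (by linarith) hb₁.2 le_rfl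
        ?_ (iW _ hb))
    · have hax := hA1.pos (x := x) ⟨hb₁.1.trans hx.1, hx.2⟩
      have : (ε₂ - ε₁) ^ 2 ≤ (x - (1 - ε₂)) ^ 2 :=
        pow_le_pow_left₀ (by linarith) (by linarith [hx.1]) 2
      gcongr
    · filter_upwards [ae_restrict_mem measurableSet_Ioc] with x hx
      have hax := hA1.pos (x := x) ⟨hb.1.trans hx.1.le, hx.2⟩
      simp only [Pi.zero_apply]
      positivity
  rw [intervalIntegral.integral_add (iA _ hb₁) (iX _ hb₁)]
  have hK : ((2 + Q / 2) / q_min + 1 / α₁) * E' ≤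
      -((2 + Q / 2) * ∫ x in (1 - ε₂)..1, sol.ut t x ^ 2) - a 1 / β₁ * sol.η₁ t ^ 2 := by
    have hp₁ : 0 ≤ q_min / α₁ * ∫ x in (1 - ε₂)..1, sol.ut t x ^ 2 := by positivity
    have hp₂ : 0 ≤ (2 + Q / 2) / q_min * (a 1 * α₁ / β₁ * sol.η₁ t ^ 2) := by positivity
    calc _ ≤ ((2 + Q / 2) / q_min + 1 / α₁) * (-(q_min * ∫ x in (1 - ε₂)..1, sol.ut t x ^ 2)
            - a 1 * α₁ / β₁ * sol.η₁ t ^ 2) := by gcongr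
      _ = -((2 + Q / 2) * ∫ x in (1 - ε₂)..1, sol.ut t x ^ 2) - a 1 / β₁ * sol.η₁ t ^ 2
          - q_min / α₁ * (∫ x in (1 - ε₂)..1, sol.ut t x ^ 2)
          - (2 + Q / 2) / q_min * (a 1 * α₁ / β₁ * sol.η₁ t ^ 2) := by
        field_simp
        ring
      _ ≤ _ := by linarith
  have hη₁ : (1 - (1 - ε₂)) ^ 2 * a 1 / β₁ * sol.η₁ t ^ 2 ≤ a 1 / β₁ * sol.η₁ t ^ 2 := by
    have : (1 - (1 - ε₂)) ^ 2 ≤ 1 := pow_le_one₀ (by linarith) (by linarith)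
    gcongr
    exact mul_le_of_le_one_left ha1.le this
  have hη₂ : κ * sol.η₂ t ^ 2 ≤ (1 - (1 - ε₂)) ^ 2 * a 1 * α₂ / β₁ * sol.η₂ t ^ 2 := by
    rw [sub_sub_cancel]
    gcongr
  have hκA := mul_le_mul_of_nonneg_right hκ₁ hA0'
  have hκX := mul_le_mul_of_nonneg_right hκ₃ hX0
  linarith

end ClassicalSolutionS

/-- Second multiplier estimate (Lemma 3.2): the localized energy near `x = 1` and the time
integral of `η₂²` are controlled by the localized `L²` norm of `u - u_*` and `E(S)`. -/
theorem multiplier_estimate_S1 (a q : ℝ → ℝ)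
    (a_min a_max ε₁ ε₂ ε₃ q_min α₁ α₂ β₁ γ₁ μ₁ : ℝ)
    (hA1 : AssumptionA1 a a_min a_max) (hA2 : AssumptionA2' q ε₃ q_min)
    (hε₁ : 0 < ε₁) (hε₁₂ : ε₁ < ε₂) (hε₂₃ : ε₂ < ε₃)
    (hα₁ : 0 < α₁) (hα₂ : 0 < α₂) (hβ₁ : 0 < β₁) (hγ₁ : 0 < γ₁) (hμ₁ : 0 < μ₁) :
    ∃ C > (0:ℝ), ∀ sol : ClassicalSolutionS a q α₁ α₂ β₁ γ₁ μ₁, ∀ S T : ℝ, 0 ≤ S → S ≤ T →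
      (∫ t in S..T, ∫ x in (1 - ε₁)..1, (sol.ut t x ^ 2 + a x * sol.ux t x ^ 2))
          + (∫ t in S..T, sol.η₂ t ^ 2)
        ≤ C * (∫ t in S..T, ∫ x in (1 - ε₂)..1, (sol.u t x - (sol.u 0 1 - sol.η₂ 0)) ^ 2)
          + C * energyS sol S := by
  obtain ⟨Q, hQ⟩ := hA2.2.1
  have h1 : (1:ℝ) ∈ Icc (0:ℝ) 1 := by simp
  have hε₃1 := hA2.2.2.2.2.1
  have hqm := hA2.2.2.2.2.2.1
  have hamin := hA1.2.1
  have hamax : 0 < a_max := hamin.trans_le hA1.2.2.1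
  have hb : 1 - ε₂ ∈ Icc (0:ℝ) 1 := ⟨by linarith, by linarith⟩
  have hb₁ : 1 - ε₁ ∈ Icc (0:ℝ) 1 := ⟨by linarith, by linarith⟩
  have ha1 := hA1.pos h1
  have hQ0 : 0 ≤ Q := (abs_nonneg _).trans (hQ 1 h1)
  have hε₂ : 0 < ε₂ := hε₁.trans hε₁₂
  have hδ : 0 < ε₂ - ε₁ := sub_pos.2 hε₁₂
  obtain ⟨κ, hκ, hκ₁, hκ₂, hκ₃⟩ : ∃ κ : ℝ, 0 < κ ∧ κ ≤ 1 ∧ κ ≤ ε₂ ^ 2 * a 1 * α₂ / β₁ ∧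
      κ ≤ (ε₂ - ε₁) ^ 2 / 2 :=
    ⟨min 1 (min (ε₂ ^ 2 * a 1 * α₂ / β₁) ((ε₂ - ε₁) ^ 2 / 2)),
      lt_min one_pos (lt_min (by positivity) (by positivity)), min_le_left _ _,
      (min_le_right _ _).trans (min_le_left _ _), (min_le_right _ _).trans (min_le_right _ _)⟩
  set K := (2 + Q / 2) / q_min + 1 / α₁ with hK
  set B := 2 * β₁ / (a 1 * α₂) + 2 / a_min + 2 + (1 + α₁) / α₂ with hB
  have hKpos : 0 < K := by positivity
  have hBpos : 0 < B := by positivity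
  refine ⟨(2 * a_max + Q / 2 + (2 * B + K)) / κ, by positivity, fun sol S T hS hST => ?_⟩
  have hIci : Icc S T ⊆ Ici 0 := fun t ht => hS.trans ht.1
  have hcD : ContinuousOn (fun t => ∫ x in (1 - ε₁)..1, (sol.ut t x ^ 2 + a x * sol.ux t x ^ 2))
      (Icc S T) :=
    (continuousOn_integral_of_continuousOn_halfStrip
      (F := fun t x => sol.ut t x ^ 2 + a x * sol.ux t x ^ 2)
      (sol.continuousOn_energyDensity hA1) hb₁).mono hIci
  have hcη : ContinuousOn (fun t => sol.η₂ t ^ 2) (Icc S T) :=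
    (sol.hη₂C1.continuousOn.pow 2).mono hIci
  have hcV : ContinuousOn (fun t => ∫ x in (1 - ε₂)..1, sol.displacement t x ^ 2) (Icc S T) :=
    (continuousOn_integral_of_continuousOn_halfStrip
      (F := fun t x => sol.displacement t x ^ 2) (sol.continuousOn_displacement.pow 2) hb).mono
      hIci
  have hcΦ : ContinuousOn (fun s => sol.multiplierFunctional (1 - ε₂) s + K * energyS sol s)
      (Icc S T) :=
    ((sol.continuousOn_multiplierFunctional hb).add
      (continuousOn_const.mul (sol.continuousOn_energyS hA1))).mono hIci
  choose! Φ' hΦ hΦle using fun t (ht : 0 < t) =>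
    sol.exists_hasDerivAt_lyapunov hA1 hA2 hε₁ hε₁₂ hε₂₃ hα₁ hβ₁ hγ₁ hμ₁ hQ hκ₁ hκ₂ hκ₃ ht
  have hmain := intervalIntegral.sub_le_integral_of_hasDeriv_right_of_le hST hcΦ
    (fun t ht => (hΦ t (hS.trans_lt ht.1)).hasDerivWithinAt)
    ((continuousOn_const.mul (hcD.add hcη)).add
      (continuousOn_const.mul hcV)).integrableOn_Icc
    (fun t ht => hΦle t (hS.trans_lt ht.1))
  have iD := hcD.intervalIntegrable_of_Icc (μ := volume) hST
  have iη := hcη.intervalIntegrable_of_Icc (μ := volume) hST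
  have iV := hcV.intervalIntegrable_of_Icc (μ := volume) hST
  have hsplit : (∫ t in S..T,
      ((-κ) * ((∫ x in (1 - ε₁)..1, (sol.ut t x ^ 2 + a x * sol.ux t x ^ 2)) + sol.η₂ t ^ 2)
        + (2 * a_max + Q / 2) * ∫ x in (1 - ε₂)..1, sol.displacement t x ^ 2))
      = (-κ) * ((∫ t in S..T, ∫ x in (1 - ε₁)..1, (sol.ut t x ^ 2 + a x * sol.ux t x ^ 2))
          + ∫ t in S..T, sol.η₂ t ^ 2)
        + (2 * a_max + Q / 2) * ∫ t in S..T, ∫ x in (1 - ε₂)..1, sol.displacement t x ^ 2 := by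
    rw [intervalIntegral.integral_add ((iD.add iη).const_mul _) (iV.const_mul _),
      intervalIntegral.integral_const_mul, intervalIntegral.integral_const_mul,
      intervalIntegral.integral_add iD iη]
  have hV0 : 0 ≤ ∫ t in S..T, ∫ x in (1 - ε₂)..1, sol.displacement t x ^ 2 :=
    intervalIntegral.integral_nonneg hST fun t _ =>
      intervalIntegral.integral_nonneg hb.2 fun x _ => sq_nonneg _
  have hES := sol.energyS_nonneg hA1 hα₂ hβ₁ hμ₁ hS
  have hET := sol.energyS_nonneg hA1 hα₂ hβ₁ hμ₁ (hS.trans hST)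
  have hTS := sol.energyS_le_of_le hA1 hA2 hα₁ hβ₁ hγ₁ hμ₁ hS hST
  have hΨS := (abs_le.1 (sol.abs_multiplierFunctional_le hA1 hα₁ hα₂ hβ₁ hμ₁ hb hS)).2
  have hΨT := (abs_le.1
    (sol.abs_multiplierFunctional_le hA1 hα₁ hα₂ hβ₁ hμ₁ hb (hS.trans hST))).1
  rw [← hB] at hΨS hΨT
  have hBT := mul_le_mul_of_nonneg_left hTS hBpos.le
  have hKT : 0 ≤ K * energyS sol T := by positivity
  change _ ≤ _ * (∫ t in S..T, ∫ x in (1 - ε₂)..1, sol.displacement t x ^ 2) + _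
  set L := (∫ t in S..T, ∫ x in (1 - ε₁)..1, (sol.ut t x ^ 2 + a x * sol.ux t x ^ 2))
    + ∫ t in S..T, sol.η₂ t ^ 2
  set V := ∫ t in S..T, ∫ x in (1 - ε₂)..1, sol.displacement t x ^ 2
  have hL : κ * L ≤ (2 * a_max + Q / 2) * V + (2 * B + K) * energyS sol S := by
    have := hmain.trans_eq hsplit
    linarith
  have hV' : 0 ≤ (2 * B + K) * V := by positivity
  have hE' : 0 ≤ (2 * a_max + Q / 2) * energyS sol S := by positivity
  calc L ≤ ((2 * a_max + Q / 2) * V + (2 * B + K) * energyS sol S) / κ := by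
        rwa [le_div_iff₀ hκ, mul_comm]
    _ ≤ ((2 * a_max + Q / 2 + (2 * B + K)) * V
          + (2 * a_max + Q / 2 + (2 * B + K)) * energyS sol S) / κ := by
        refine div_le_div_of_nonneg_right ?_ hκ.le
        linarith
    _ = _ := by ring
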